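/- For ν ∈ ℝ and t > 0, the function K_ν(t) = ∫₀^∞ exp(−t cosh ζ) cosh(νζ) dζ satisfies the modified Bessel equation t² K_ν''(t) + t K_ν'(t) − (t² + ν²) K_ν(t) = 0. -/

import Mathlib

open MeasureTheory Real Set

/-- The modified Bessel function of the second kind,
`K_ν(t) = ∫₀^∞ exp(−t cosh ζ) cosh(νζ) dζ`. -/
noncomputable def besselK (ν t : ℝ) : ℝ :=
  ∫ ζ in Set.Ioi (0:ℝ), Real.exp (-t * Real.cosh ζ) * Real.cosh (ν * ζ)

/-- The integrand of the `n`-th derivative of `besselK ν`, up to the sign `(-1) ^ n`. -/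
noncomputable def besselKIntegrand (ν : ℝ) (n : ℕ) (t ζ : ℝ) : ℝ :=
  cosh ζ ^ n * (exp (-t * cosh ζ) * cosh (ν * ζ))

lemma besselKIntegrand_nonneg (ν : ℝ) (n : ℕ) (t ζ : ℝ) : 0 ≤ besselKIntegrand ν n t ζ := by
  have := (cosh_pos ζ).le
  have := (cosh_pos (ν * ζ)).le
  unfold besselKIntegrand
  positivity

lemma continuous_besselKIntegrand (ν : ℝ) (n : ℕ) (t : ℝ) :
    Continuous (besselKIntegrand ν n t) := by
  unfold besselKIntegrand
  fun_prop

lemma cosh_le_exp_abs (x : ℝ) : cosh x ≤ exp |x| := by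
  rw [← cosh_abs, cosh_eq]
  have : exp (-|x|) ≤ exp |x| := exp_le_exp.2 (by linarith [abs_nonneg x])
  linarith

lemma abs_sinh_le_cosh (x : ℝ) : |sinh x| ≤ cosh x :=
  abs_le_of_sq_le_sq (by linarith [cosh_sq x]) (cosh_pos x).le

lemma half_sq_le_cosh {x : ℝ} (hx : 0 ≤ x) : x ^ 2 / 2 ≤ cosh x := by
  have h := self_le_sinh_iff.2 (by linarith : 0 ≤ x / 2)
  have h₂ := cosh_two_mul (x / 2)
  rw [mul_div_cancel₀ _ two_ne_zero, cosh_sq] at h₂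
  nlinarith

lemma besselKIntegrand_le (ν : ℝ) (n : ℕ) {t ζ : ℝ} (ht : 0 < t) (hζ : 0 ≤ ζ) :
    besselKIntegrand ν n t ζ ≤ exp ((n + |ν| + 1) ^ 2 / (2 * t)) * exp (-ζ) := by
  have h₁ : cosh ζ ^ n ≤ exp (n * ζ) := by
    rw [exp_nat_mul]
    refine pow_le_pow_left₀ (cosh_pos ζ).le ?_ n
    simpa [abs_of_nonneg hζ] using cosh_le_exp_abs ζ
  have h₂ : cosh (ν * ζ) ≤ exp (|ν| * ζ) := by
    simpa [abs_mul, abs_of_nonneg hζ] using cosh_le_exp_abs (ν * ζ)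
  have h₃ : exp (-t * cosh ζ) ≤ exp (-t * (ζ ^ 2 / 2)) :=
    exp_le_exp.2 (by nlinarith [half_sq_le_cosh hζ])
  calc besselKIntegrand ν n t ζ
      ≤ exp (n * ζ) * (exp (-t * (ζ ^ 2 / 2)) * exp (|ν| * ζ)) := by
        unfold besselKIntegrand
        have := (cosh_pos ζ).le
        have := (cosh_pos (ν * ζ)).le
        gcongr
    _ ≤ exp ((n + |ν| + 1) ^ 2 / (2 * t)) * exp (-ζ) := by
        simp only [← exp_add]
        refine exp_le_exp.2 ?_
        have : (n + |ν| + 1) ^ 2 / (2 * t) + -ζ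
            - (n * ζ + (-t * (ζ ^ 2 / 2) + |ν| * ζ)) = (n + |ν| + 1 - t * ζ) ^ 2 / (2 * t) := by
          field_simp
          ring
        have : 0 ≤ (n + |ν| + 1 - t * ζ) ^ 2 / (2 * t) := by positivity
        linarith

lemma integrableOn_besselKIntegrand (ν : ℝ) (n : ℕ) {t : ℝ} (ht : 0 < t) :
    IntegrableOn (besselKIntegrand ν n t) (Ioi 0) := by
  refine Integrable.mono' ((integrableOn_exp_neg_Ioi 0).const_mul
      (exp ((n + |ν| + 1) ^ 2 / (2 * t))))
    (continuous_besselKIntegrand ν n t).aestronglyMeasurable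
    ((ae_restrict_iff' measurableSet_Ioi).2 (.of_forall fun ζ hζ ↦ ?_))
  rw [norm_of_nonneg (besselKIntegrand_nonneg ν n t ζ)]
  exact besselKIntegrand_le ν n ht (mem_Ioi.1 hζ).le

lemma tendsto_besselKIntegrand (ν : ℝ) (n : ℕ) {t : ℝ} (ht : 0 < t) :
    Filter.Tendsto (besselKIntegrand ν n t) Filter.atTop (nhds 0) := by
  refine squeeze_zero' (.of_forall (besselKIntegrand_nonneg ν n t))
    ((Filter.eventually_ge_atTop 0).mono fun ζ hζ ↦ besselKIntegrand_le ν n ht hζ) ?_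
  simpa using tendsto_exp_neg_atTop_nhds_zero.const_mul (exp ((n + |ν| + 1) ^ 2 / (2 * t)))

lemma besselKIntegrand_antitone (ν : ℝ) (n : ℕ) (ζ : ℝ) :
    Antitone fun t ↦ besselKIntegrand ν n t ζ := by
  intro s t hst
  have := (cosh_pos ζ).le
  have := (cosh_pos (ν * ζ)).le
  simp only [besselKIntegrand]
  gcongr

lemma hasDerivAt_besselKIntegrand (ν : ℝ) (n : ℕ) (t ζ : ℝ) :
    HasDerivAt (fun t ↦ besselKIntegrand ν n t ζ) (-besselKIntegrand ν (n + 1) t ζ) t := by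
  unfold besselKIntegrand
  have h := ((((hasDerivAt_id t).neg.mul_const (cosh ζ)).exp).mul_const
    (cosh (ν * ζ))).const_mul (cosh ζ ^ n)
  refine h.congr_deriv ?_
  simp only [Pi.neg_apply, id_eq]
  ring

lemma hasDerivAt_integral_besselKIntegrand (ν : ℝ) (n : ℕ) {t : ℝ} (ht : 0 < t) :
    HasDerivAt (fun t ↦ ∫ ζ in Ioi (0 : ℝ), besselKIntegrand ν n t ζ)
      (-∫ ζ in Ioi (0 : ℝ), besselKIntegrand ν (n + 1) t ζ) t := by
  rw [← integral_neg]
  refine (hasDerivAt_integral_of_dominated_loc_of_deriv_le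
    (F' := fun t ζ ↦ -besselKIntegrand ν (n + 1) t ζ)
    (bound := besselKIntegrand ν (n + 1) (t / 2))
    (Ioi_mem_nhds (half_lt_self ht))
    (.of_forall fun s ↦ (continuous_besselKIntegrand ν n s).aestronglyMeasurable)
    (integrableOn_besselKIntegrand ν n ht)
    (continuous_besselKIntegrand ν (n + 1) t).neg.aestronglyMeasurable
    (.of_forall fun ζ s hs ↦ ?_)
    (integrableOn_besselKIntegrand ν (n + 1) (half_pos ht))
    (.of_forall fun ζ s _ ↦ hasDerivAt_besselKIntegrand ν n s ζ)).2
  rw [norm_neg, norm_of_nonneg (besselKIntegrand_nonneg ν (n + 1) s ζ)]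
  exact besselKIntegrand_antitone ν (n + 1) ζ (mem_Ioi.1 hs).le

lemma besselK_eq_integral (ν : ℝ) :
    besselK ν = fun t ↦ ∫ ζ in Ioi (0 : ℝ), besselKIntegrand ν 0 t ζ := by
  funext t
  simp [besselK, besselKIntegrand]

lemma deriv_besselK (ν : ℝ) {t : ℝ} (ht : 0 < t) :
    deriv (besselK ν) t = -∫ ζ in Ioi (0 : ℝ), besselKIntegrand ν 1 t ζ := by
  rw [besselK_eq_integral]
  exact (hasDerivAt_integral_besselKIntegrand ν 0 ht).deriv

lemma deriv_deriv_besselK (ν : ℝ) {t : ℝ} (ht : 0 < t) :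
    deriv (deriv (besselK ν)) t = ∫ ζ in Ioi (0 : ℝ), besselKIntegrand ν 2 t ζ := by
  have h : deriv (besselK ν) =ᶠ[nhds t]
      fun s ↦ -∫ ζ in Ioi (0 : ℝ), besselKIntegrand ν 1 s ζ :=
    (eventually_gt_nhds ht).mono fun s hs ↦ deriv_besselK ν hs
  rw [h.deriv_eq]
  simpa using (hasDerivAt_integral_besselKIntegrand ν 1 ht).neg.deriv

/-- A primitive in `ζ` of the modified Bessel operator applied to the integrand of `besselK`. -/
lemma hasDerivAt_besselK_primitive (ν t ζ : ℝ) :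
    HasDerivAt (fun ζ ↦ -(exp (-t * cosh ζ) * (t * sinh ζ * cosh (ν * ζ) + ν * sinh (ν * ζ))))
      (t ^ 2 * besselKIntegrand ν 2 t ζ - t * besselKIntegrand ν 1 t ζ
        - (t ^ 2 + ν ^ 2) * besselKIntegrand ν 0 t ζ) ζ := by
  have hν : HasDerivAt (fun ζ ↦ ν * ζ) ν ζ := by simpa using (hasDerivAt_id ζ).const_mul ν
  have h := ((((hasDerivAt_cosh ζ).const_mul (-t)).exp).mul
    ((((hasDerivAt_sinh ζ).const_mul t).mul hν.cosh).add (hν.sinh.const_mul ν))).neg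
  refine h.congr_deriv ?_
  simp only [besselKIntegrand, cosh_sq, Pi.add_apply, Pi.mul_apply]
  ring

lemma tendsto_besselK_primitive (ν : ℝ) {t : ℝ} (ht : 0 < t) :
    Filter.Tendsto
      (fun ζ ↦ -(exp (-t * cosh ζ) * (t * sinh ζ * cosh (ν * ζ) + ν * sinh (ν * ζ))))
      Filter.atTop (nhds 0) := by
  refine squeeze_zero_norm
    (a := fun ζ ↦ t * besselKIntegrand ν 1 t ζ + |ν| * besselKIntegrand ν 0 t ζ)
    (fun ζ ↦ ?_) ?_
  · have h : |t * sinh ζ * cosh (ν * ζ) + ν * sinh (ν * ζ)|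
        ≤ t * cosh ζ * cosh (ν * ζ) + |ν| * cosh (ν * ζ) := by
      refine (abs_add_le _ _).trans ?_
      have := (cosh_pos (ν * ζ)).le
      rw [abs_mul, abs_mul, abs_mul, abs_of_pos ht, abs_of_nonneg this]
      gcongr <;> exact abs_sinh_le_cosh _
    rw [norm_neg, norm_mul, norm_of_nonneg (exp_pos _).le, norm_eq_abs]
    refine (mul_le_mul_of_nonneg_left h (exp_pos _).le).trans_eq ?_
    simp only [besselKIntegrand]
    ring
  · simpa using ((tendsto_besselKIntegrand ν 1 ht).const_mul t).add
      ((tendsto_besselKIntegrand ν 0 ht).const_mul |ν|)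

/-- For `ν ∈ ℝ` and `t > 0`, the function `K_ν` satisfies the modified Bessel
equation `t² K_ν''(t) + t K_ν'(t) − (t² + ν²) K_ν(t) = 0`. -/
theorem besselK_satisfies_modified_bessel_equation (ν t : ℝ) (ht : 0 < t) :
    t ^ 2 * deriv (deriv (besselK ν)) t + t * deriv (besselK ν) t
      - (t ^ 2 + ν ^ 2) * besselK ν t = 0 := by
  have h₀ := (integrableOn_besselKIntegrand ν 0 ht).const_mul (t ^ 2 + ν ^ 2)
  have h₁ := (integrableOn_besselKIntegrand ν 1 ht).const_mul t
  have h₂ := (integrableOn_besselKIntegrand ν 2 ht).const_mul (t ^ 2)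
  have key := integral_Ioi_of_hasDerivAt_of_tendsto' (a := 0)
    (fun ζ _ ↦ hasDerivAt_besselK_primitive ν t ζ) ((h₂.sub h₁).sub h₀)
    (tendsto_besselK_primitive ν ht)
  rw [integral_sub (by exact h₂.sub h₁) h₀, integral_sub h₂ h₁] at key
  simp only [integral_const_mul, mul_zero, sinh_zero, zero_mul, add_zero, neg_zero, sub_zero]
    at key
  rw [deriv_deriv_besselK ν ht, deriv_besselK ν ht, besselK_eq_integral]
  linarith
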